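/- arXiv:2203.00755 — 4 statements merged into one kernel-verified Lean document; each statement's English description precedes it below -/
import Mathlib

section
/- Let $K$ be a number field, $r, e \ge 1$, and let $\phi = (\phi_1,\dots,\phi_e) : \mathbb{Z}^r \to (K^{\times})^e$ be an injective group homomorphism (where $(K^{\times})^e$ carries the multiplicative group structure). Then there exist constants $C_2 > C_1 > 0$ such that for every $\mathbf{n} \in \mathbb{Z}^r$: $C_1 \|\mathbf{n}\|_{\infty} \le h_{\mathrm{aff}}(\phi_1(\mathbf{n})) + \cdots + h_{\mathrm{aff}}(\phi_e(\mathbf{n})) \le C_2 \|\mathbf{n}\|_{\infty}$. -/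
open scoped BigOperators nonZeroDivisors

noncomputable section

namespace PEP

/-- A purely exponential polynomial in `r` variables with prescribed bases `lam`. -/
def IsPEPolyWith (K : Type*) [Field K] {k r : ℕ}
    (lam : Fin k → (AlgebraicClosure K)ˣ) (f : (Fin r → ℤ) → AlgebraicClosure K) : Prop :=
  ∃ (e : ℕ) (a : Fin e → (AlgebraicClosure K)ˣ)
    (l : Fin k → Fin e → ((Fin r → ℤ) →+ ℤ)),
    ∀ n : Fin r → ℤ,
      f n = ∑ j : Fin e, (a j : AlgebraicClosure K) *
        ∏ i : Fin k, ((lam i ^ (l i j n) : (AlgebraicClosure K)ˣ) : AlgebraicClosure K)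

/-- A purely exponential polynomial in `r` variables over a field `K`. -/
def IsPEPoly (K : Type*) [Field K] {r : ℕ} (f : (Fin r → ℤ) → AlgebraicClosure K) : Prop :=
  ∃ (k : ℕ) (lam : Fin k → (AlgebraicClosure K)ˣ), IsPEPolyWith K lam f

/-- A subset of `K^ι` admitting a purely exponential parametrization in `r` variables. -/
def IsPEPSet (K : Type*) [Field K] {ι : Type*} [Fintype ι] (r : ℕ)
    (S : Set (ι → K)) : Prop :=
  ∃ f : ι → ((Fin r → ℤ) → AlgebraicClosure K),
    (∀ i, IsPEPoly K (f i)) ∧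
    (∀ m : Fin r → ℤ, ∃ x ∈ S, ∀ i, algebraMap K (AlgebraicClosure K) (x i) = f i m) ∧
    (∀ x ∈ S, ∃ m : Fin r → ℤ, ∀ i, algebraMap K (AlgebraicClosure K) (x i) = f i m)

/-- The sup-norm of an integer vector. -/
def zNorm {r : ℕ} (n : Fin r → ℤ) : ℕ := Finset.univ.sup fun i => (n i).natAbs

open NumberField

/-- The "denominator" fractional ideal generated by `1` and the coordinates of `x`. -/
def denomIdeal {K : Type*} [Field K] [NumberField K] {ι : Type*} [Fintype ι]
    (x : ι → K) : FractionalIdeal (𝓞 K)⁰ K :=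
  1 + ∑ i : ι, FractionalIdeal.spanSingleton (𝓞 K)⁰ (x i)

/-- The affine multiplicative (Weil) height of a tuple of elements of a number field,
normalized so as to be independent of the field. -/
def mulHeight {K : Type*} [Field K] [NumberField K] {ι : Type*} [Fintype ι]
    (x : ι → K) : ℝ :=
  ((∏ w : InfinitePlace K, max 1 (⨆ i : ι, w (x i)) ^ w.mult) *
      (((FractionalIdeal.absNorm (denomIdeal x) : ℚ) : ℝ))⁻¹) ^
    ((Module.finrank ℚ K : ℝ)⁻¹)

/-- The logarithmic affine height of a tuple. -/
def logHeight {K : Type*} [Field K] [NumberField K] {ι : Type*} [Fintype ι]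
    (x : ι → K) : ℝ :=
  Real.log (mulHeight x)

/-- The logarithmic height of a single element of a number field. -/
def logHeight₁ {K : Type*} [Field K] [NumberField K] (x : K) : ℝ :=
  logHeight (fun _ : Fin 1 => x)

/-- A matrix over `K` is semi-simple if it is diagonalizable over an algebraic closure. -/
def IsSemisimpleMat {K : Type*} [Field K] {n : ℕ} (A : Matrix (Fin n) (Fin n) K) : Prop :=
  ∃ (P : (Matrix (Fin n) (Fin n) (AlgebraicClosure K))ˣ) (d : Fin n → AlgebraicClosure K),
    (↑P⁻¹ : Matrix (Fin n) (Fin n) (AlgebraicClosure K)) *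
      A.map (algebraMap K (AlgebraicClosure K)) * (P : Matrix (Fin n) (Fin n) (AlgebraicClosure K)) =
      Matrix.diagonal d

/-- The tuple of entries of a matrix, as a point of affine `n²`-space. -/
def entries {K : Type*} [Field K] {n : ℕ} (A : Matrix (Fin n) (Fin n) K) :
    (Fin n × Fin n) → K := fun p => A p.1 p.2

end PEP

namespace PEP

open NumberField

/-- The sup-norm of a vector bounds the absolute values of its coordinates. -/
lemma natAbs_le_zNorm {r : ℕ} (n : Fin r → ℤ) (i : Fin r) : (n i).natAbs ≤ zNorm n :=
  Finset.le_sup (f := fun i => (n i).natAbs) (Finset.mem_univ i)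

lemma exists_natAbs_eq_zNorm {r : ℕ} {n : Fin r → ℤ} (h : zNorm n ≠ 0) :
    ∃ i, (n i).natAbs = zNorm n := by
  have hne : (Finset.univ : Finset (Fin r)).Nonempty := by
    by_contra hemp
    rw [Finset.not_nonempty_iff_eq_empty] at hemp
    exact h (by simp [zNorm, hemp])
  obtain ⟨i, -, hi⟩ := Finset.exists_mem_eq_sup _ hne fun i => (n i).natAbs
  exact ⟨i, hi.symm⟩

/-- Simultaneous approximation in the sense of Dirichlet: some multiple `q • n` with
`q ≤ Q ^ r` lies within `‖n‖ / Q` of a nonzero element of `‖n‖ • ℤ^r`. -/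
lemma exists_simultaneous_approx {r : ℕ} (n : Fin r → ℤ) (hn : zNorm n ≠ 0) {Q : ℕ}
    (hQ : 1 < Q) :
    ∃ (q : ℕ) (m : Fin r → ℤ), q ≤ Q ^ r ∧ m ≠ 0 ∧
      Q * zNorm (q • n - zNorm n • m) ≤ zNorm n := by
  set N := zNorm n with hN
  have hNpos : (0 : ℤ) < N := by omega
  have hlt (k : ℕ) (i : Fin r) : ((Q * ((k * n i) % N)) / N).toNat < Q := by
    have h1 := Int.emod_lt_of_pos (k * n i) hNpos
    have h2 : (Q * ((k * n i) % N)) / N < (Q : ℤ) := by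
      apply Int.ediv_lt_of_lt_mul hNpos
      exact mul_lt_mul_of_pos_left h1 (by omega)
    omega
  let f : Fin (Q ^ r + 1) → (Fin r → Fin Q) := fun k i => ⟨_, hlt k i⟩
  obtain ⟨x, y, hxy, hf⟩ := Fintype.exists_ne_map_eq_of_card_lt f (by simp)
  wlog hlt' : x < y generalizing x y
  · exact this y x hxy.symm hf.symm (lt_of_le_of_ne (not_lt.mp hlt') hxy.symm)
  have hxy' : (x : ℕ) < y := hlt'
  let m : Fin r → ℤ := fun i => ((y : ℕ) * n i) / N - ((x : ℕ) * n i) / N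
  have hdiff (i : Fin r) : (((y : ℕ) - (x : ℕ) : ℕ) • n - N • m) i =
      ((y : ℕ) * n i) % N - ((x : ℕ) * n i) % N := by
    have h1 := Int.emod_add_mul_ediv ((y : ℕ) * n i) N
    have h2 := Int.emod_add_mul_ediv ((x : ℕ) * n i) N
    rw [Pi.sub_apply, Pi.smul_apply, Pi.smul_apply, nsmul_eq_mul, nsmul_eq_mul,
      Nat.cast_sub hxy'.le]
    simp only [m]
    linear_combination h2 - h1
  have hclose (i : Fin r) :
      Q * |(((y : ℕ) - (x : ℕ) : ℕ) • n - N • m) i| < (N : ℤ) := by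
    have hfi : ((Q * (((x : ℕ) * n i) % N)) / N).toNat = ((Q * (((y : ℕ) * n i) % N)) / N).toNat :=
      congrArg Fin.val (congrFun hf i)
    have hx0 := Int.emod_nonneg ((x : ℕ) * n i) hNpos.ne'
    have hy0 := Int.emod_nonneg ((y : ℕ) * n i) hNpos.ne'
    have hx1 : 0 ≤ (Q * (((x : ℕ) * n i) % N)) / (N : ℤ) := Int.ediv_nonneg (by positivity) hNpos.le
    have hy1 : 0 ≤ (Q * (((y : ℕ) * n i) % N)) / (N : ℤ) := Int.ediv_nonneg (by positivity) hNpos.le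
    have heq : (Q * (((x : ℕ) * n i) % N)) / (N : ℤ) = (Q * (((y : ℕ) * n i) % N)) / N := by omega
    rw [hdiff, ← Nat.abs_cast Q, ← abs_mul, mul_sub, abs_lt]
    have a1 := Int.emod_add_mul_ediv (Q * (((y : ℕ) * n i) % N)) N
    have a2 := Int.emod_add_mul_ediv (Q * (((x : ℕ) * n i) % N)) N
    rw [heq] at a2
    have b1 := Int.emod_nonneg (Q * (((y : ℕ) * n i) % N)) hNpos.ne'
    have b2 := Int.emod_nonneg (Q * (((x : ℕ) * n i) % N)) hNpos.ne'
    have c1 := Int.emod_lt_of_pos (Q * (((y : ℕ) * n i) % N)) hNpos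
    have c2 := Int.emod_lt_of_pos (Q * (((x : ℕ) * n i) % N)) hNpos
    constructor <;> linarith
  refine ⟨y - x, m, by omega, ?_, ?_⟩
  · intro hm
    obtain ⟨i, hi⟩ := exists_natAbs_eq_zNorm hn
    have h := hclose i
    have hi' : |n i| = (N : ℤ) := by rw [Int.abs_eq_natAbs, hi]
    rw [hm, smul_zero, sub_zero, Pi.smul_apply, nsmul_eq_mul, abs_mul, hi', Nat.abs_cast] at h
    have h1 : (1 : ℤ) ≤ ((y - x : ℕ) : ℤ) := by omega
    have h2 : (1 : ℤ) < Q := by omega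
    nlinarith [mul_le_mul_of_nonneg_right h1 hNpos.le]
  · by_cases h0 : zNorm (((y : ℕ) - (x : ℕ) : ℕ) • n - N • m) = 0
    · rw [h0, mul_zero]; exact Nat.zero_le _
    · obtain ⟨i, hi⟩ := exists_natAbs_eq_zNorm h0
      have h := hclose i
      rw [← hi]
      zify
      exact h.le

/-- A seminorm-like function on `ℤ^r` that is bounded away from zero off the origin dominates a
positive multiple of the sup-norm. -/
lemma exists_pos_mul_zNorm_le {r : ℕ} (H : (Fin r → ℤ) → ℝ)
    (hadd : ∀ m n, H (m + n) ≤ H m + H n) (hsmul : ∀ (k : ℕ) n, H (k • n) = k * H n)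
    (hneg : ∀ n, H (-n) = H n) {C : ℝ} (hC : ∀ n, H n ≤ C * zNorm n)
    {δ : ℝ} (hδ : 0 < δ) (hle : ∀ n, n ≠ 0 → δ ≤ H n) :
    ∃ c : ℝ, 0 < c ∧ ∀ n, c * zNorm n ≤ H n := by
  obtain ⟨Q₀, hQ₀⟩ := exists_nat_gt (2 * C / δ)
  set Q := Q₀ + 2
  have hQpos : (0 : ℝ) < Q := by positivity
  have hQ : 2 * C < Q * δ := by
    rw [div_lt_iff₀ hδ] at hQ₀
    push_cast [Q]
    linarith
  have h0 : H 0 = 0 := by simpa using hsmul 0 0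
  have hnonneg (n) : 0 ≤ H n := by
    rcases eq_or_ne n 0 with rfl | hn
    · exact h0.ge
    · exact hδ.le.trans (hle n hn)
  refine ⟨δ / (2 * Q ^ r), by positivity, fun n => ?_⟩
  rcases eq_or_ne (zNorm n) 0 with hn | hn
  · simpa [hn] using hnonneg n
  obtain ⟨q, m, hqQ, hm, happ⟩ := exists_simultaneous_approx n hn (Q := Q) (by omega)
  have hq : (q : ℝ) ≤ Q ^ r := mod_cast hqQ
  have happ' : (Q : ℝ) * zNorm (q • n - zNorm n • m) ≤ zNorm n := mod_cast happ
  have hN : (0 : ℝ) < zNorm n := by positivity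
  have h1 : zNorm n * H m ≤ q * H n + H (q • n - zNorm n • m) := by
    rw [← hsmul, ← hsmul, ← hneg (q • n - _)]
    convert hadd (q • n) (-(q • n - zNorm n • m)) using 2
    abel
  have h2 := hC (q • n - zNorm n • m)
  have h3 : H (q • n - zNorm n • m) ≤ zNorm n * δ / 2 := by
    rcases le_or_gt C 0 with hC0 | hC0
    · exact h2.trans ((mul_nonpos_of_nonpos_of_nonneg hC0 (by positivity)).trans (by positivity))
    · have h4 : Q * H (q • n - zNorm n • m) ≤ Q * (zNorm n * δ / 2) := by
        nlinarith [mul_le_mul_of_nonneg_left happ' hC0.le, mul_le_mul_of_nonneg_left h2 hQpos.le,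
          mul_lt_mul_of_pos_right hQ hN]
      exact le_of_mul_le_mul_left h4 hQpos
  have h5 := mul_le_mul_of_nonneg_left (hle m hm) hN.le
  have h6 := mul_le_mul_of_nonneg_right hq (hnonneg n)
  rw [div_mul_eq_mul_div, div_le_iff₀ (by positivity)]
  nlinarith

/-- A subadditive homogeneous function on `ℤ^r` is bounded by a multiple of the sup-norm. -/
lemma exists_le_mul_zNorm {r : ℕ} (H : (Fin r → ℤ) → ℝ)
    (hadd : ∀ m n, H (m + n) ≤ H m + H n) (hsmul : ∀ (k : ℤ) n, H (k • n) = k.natAbs * H n)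
    (hnonneg : ∀ n, 0 ≤ H n) : ∃ C : ℝ, ∀ n, H n ≤ C * zNorm n := by
  have h0 : H 0 = 0 := by simpa using hsmul 0 0
  refine ⟨∑ j, H (Pi.single j 1), fun n => ?_⟩
  have hn : n = ∑ j, n j • (Pi.single j 1 : Fin r → ℤ) := by
    simp only [← Pi.single_smul, smul_eq_mul, mul_one, Finset.univ_sum_single]
  calc H n = H (∑ j, n j • (Pi.single j 1 : Fin r → ℤ)) := congrArg H hn
    _ ≤ ∑ j, H (n j • (Pi.single j 1 : Fin r → ℤ)) :=
      Finset.le_sum_of_subadditive H h0.le hadd _ _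
    _ ≤ (∑ j, H (Pi.single j 1)) * zNorm n := by
      rw [Finset.sum_mul]
      gcongr with j
      rw [hsmul, mul_comm]
      exact mul_le_mul_of_nonneg_left (mod_cast natAbs_le_zNorm n j) (hnonneg _)

/-- A homogeneous function on `ℤ^r` with a finite sublevel set is bounded away from zero off the
origin. -/
lemma exists_pos_le_of_finite {r : ℕ} (H : (Fin r → ℤ) → ℝ)
    (hsmul : ∀ (k : ℤ) n, H (k • n) = k.natAbs * H n) (hnonneg : ∀ n, 0 ≤ H n)
    (hfin : {n | H n ≤ 1}.Finite) : ∃ δ : ℝ, 0 < δ ∧ ∀ n, n ≠ 0 → δ ≤ H n := by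
  have hpos (n) (hn : n ≠ 0) : 0 < H n := by
    refine (hnonneg n).lt_of_ne fun h => ?_
    refine Set.infinite_of_injective_forall_mem (smul_left_injective ℤ hn) (fun k => ?_) hfin
    rw [Set.mem_ofPred_eq, hsmul, ← h, mul_zero]
    exact zero_le_one
  rcases ({n | H n ≤ 1} \ {0}).eq_empty_or_nonempty with hS | hS
  · refine ⟨1, one_pos, fun n hn => ?_⟩
    by_contra! h
    exact Set.notMem_empty n (hS ▸ ⟨h.le, hn⟩)
  · obtain ⟨a, ha, hmin⟩ := Set.exists_min_image _ H hfin.sdiff hS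
    refine ⟨H a, hpos a ha.2, fun n hn => ?_⟩
    rcases le_total (H n) 1 with h | h
    · exact hmin n ⟨h, hn⟩
    · exact ha.1.trans h

/-- The norm of the denominator ideal is the inverse of the finite part of the height. -/
lemma absNorm_denomIdeal_mul_finprod {K : Type*} [Field K] [NumberField K] (x : K) (hx : x ≠ 0) :
    ((FractionalIdeal.absNorm (denomIdeal fun _ : Fin 1 => x) : ℚ) : ℝ) *
      ∏ᶠ v : FinitePlace K, max (v x) 1 = 1 := by
  obtain ⟨a, b, hb, hab⟩ := IsFractionRing.div_surjective (A := 𝓞 K) x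
  have hb0 : b ≠ 0 := nonZeroDivisors.ne_zero hb
  have hbK : (b : K) ≠ 0 := mod_cast hb0
  have hxb : x * (b : K) = a := by rw [← hab]; exact div_mul_cancel₀ _ hbK
  have hF := absNorm_mul_finprod_finitePlace_eq_one (K := K) (x := ![a, b])
    fun h => hb0 (congrFun h 1)
  have hG := absNorm_mul_finprod_finitePlace_eq_one (K := K) (x := ![b])
    fun h => hb0 (congrFun h 0)
  have hideal : denomIdeal (fun _ : Fin 1 => x) * (Ideal.span (Set.range ![b]) : Ideal (𝓞 K)) =
      (Ideal.span (Set.range ![a, b]) : Ideal (𝓞 K)) := by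
    have hr : Set.range ![b] = {b} := by simp
    have hr' : Set.range ![a, b] = {b} ∪ {a} := by
      simp [Matrix.range_cons, Set.pair_comm]
    rw [hr, hr', Ideal.span_union, FractionalIdeal.coeIdeal_span_singleton,
      FractionalIdeal.coeIdeal_sup, FractionalIdeal.coeIdeal_span_singleton,
      FractionalIdeal.coeIdeal_span_singleton]
    simp only [denomIdeal, Finset.univ_unique, Finset.sum_const, Finset.card_singleton, one_smul,
      add_mul, one_mul, FractionalIdeal.spanSingleton_mul_spanSingleton]
    rw [hxb]
  have hnorm := congrArg (fun I => ((FractionalIdeal.absNorm I : ℚ) : ℝ)) hideal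
  simp only [map_mul, FractionalIdeal.coeIdeal_absNorm, Rat.cast_mul, Rat.cast_natCast] at hnorm
  have hfin : ∏ᶠ v : FinitePlace K, ⨆ i, v (![a, b] i : K) =
      (∏ᶠ v : FinitePlace K, ⨆ i, v (![b] i : K)) * ∏ᶠ v : FinitePlace K, max (v x) 1 := by
    rw [← finprod_mul_distrib]
    · refine finprod_congr fun v => ?_
      have h2 : ⨆ i, v (![a, b] i : K) = max (v a) (v b) :=
        le_antisymm (ciSup_le fun i => by fin_cases i <;> simp)
          (max_le (le_ciSup (f := fun i => v (![a, b] i : K)) (Set.finite_range _).bddAbove 0)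
            (le_ciSup (f := fun i => v (![a, b] i : K)) (Set.finite_range _).bddAbove 1))
      have h1 : ⨆ i, v (![b] i : K) = v b := by simp
      rw [h1, h2, mul_max_of_nonneg _ _ (apply_nonneg v _), ← map_mul, mul_comm (b : K), hxb,
        mul_one]
    · simpa using FinitePlace.hasFiniteMulSupport hbK
    · exact (FinitePlace.hasFiniteMulSupport hx).max (by simp [Function.HasFiniteMulSupport])
  rw [hfin, ← hnorm] at hF
  linear_combination hF - (FractionalIdeal.absNorm (denomIdeal fun _ : Fin 1 => x) : ℚ) *
      (∏ᶠ v : FinitePlace K, max (v x) 1) * hG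

/-- The height is Mathlib's field-dependent height divided by the degree. -/
lemma logHeight₁_eq_div_finrank {K : Type*} [Field K] [NumberField K] (x : K) (hx : x ≠ 0) :
    logHeight₁ x = Height.logHeight₁ x / Module.finrank ℚ K := by
  have hfin := eq_inv_of_mul_eq_one_right (absNorm_denomIdeal_mul_finprod x hx)
  have hmul : mulHeight (fun _ : Fin 1 => x) =
      Height.mulHeight₁ x ^ ((Module.finrank ℚ K : ℝ)⁻¹) := by
    rw [NumberField.mulHeight₁_eq, hfin]
    simp [mulHeight, max_comm]
  rw [logHeight₁, logHeight, hmul, Real.log_rpow (Height.mulHeight₁_pos x), div_eq_inv_mul,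
    Height.logHeight₁_eq_log_mulHeight₁]

end PEP

open PEP in
/-- For an injective group homomorphism `φ = (φ₁, …, φ_e) : ℤ^r → (K^×)^e` (`K` a number
field), the sum of the logarithmic heights `h(φ₁(n)) + ⋯ + h(φ_e(n))` is bounded above and
below by positive constant multiples of `‖n‖_∞`. -/
theorem height_comparable_sup_norm {K : Type*} [Field K] [NumberField K] {r e : ℕ}
    (φ : (Fin r → ℤ) → (Fin e → Kˣ))
    (hhom : ∀ m m' : Fin r → ℤ, φ (m + m') = φ m * φ m')
    (hinj : Function.Injective φ) :
    ∃ C₁ C₂ : ℝ, 0 < C₁ ∧ C₁ < C₂ ∧ ∀ n : Fin r → ℤ,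
      C₁ * (zNorm n : ℝ) ≤ ∑ i, logHeight₁ ((φ n i : K)) ∧
      ∑ i, logHeight₁ ((φ n i : K)) ≤ C₂ * (zNorm n : ℝ) := by
  let Φ : (Fin r → ℤ) →+ Additive (Fin e → Kˣ) :=
    AddMonoidHom.mk' (fun n => Additive.ofMul (φ n)) hhom
  have hzpow (k : ℤ) (n : Fin r → ℤ) : φ (k • n) = φ n ^ k := map_zsmul Φ k n
  have hd : (0 : ℝ) < Module.finrank ℚ K := mod_cast Module.finrank_pos
  have hlog (u : Kˣ) : logHeight₁ (u : K) = Height.logHeight₁ (u : K) / Module.finrank ℚ K :=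
    logHeight₁_eq_div_finrank _ u.ne_zero
  have hlog0 (u : Kˣ) : 0 ≤ logHeight₁ (u : K) := by
    rw [hlog]
    exact div_nonneg (Height.zero_le_logHeight₁ _) hd.le
  set H : (Fin r → ℤ) → ℝ := fun n => ∑ i, logHeight₁ (φ n i : K) with hH
  have hnonneg (n) : 0 ≤ H n := Finset.sum_nonneg fun i _ => hlog0 _
  have hadd (m n) : H (m + n) ≤ H m + H n := by
    simp only [hH, ← Finset.sum_add_distrib]
    gcongr with i
    rw [hhom, Pi.mul_apply, hlog, hlog, hlog, ← add_div, Units.val_mul]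
    gcongr
    exact Height.logHeight₁_mul_le _ _
  have hsmul (k : ℤ) (n) : H (k • n) = k.natAbs * H n := by
    simp only [hH, Finset.mul_sum]
    refine Finset.sum_congr rfl fun i _ => ?_
    rw [hzpow, Pi.pow_apply, hlog, hlog, Units.val_zpow_eq_zpow_val, Height.logHeight₁_zpow,
      mul_div_assoc]
  have hfin : {n | H n ≤ 1}.Finite := by
    have hunits : {u : Kˣ | logHeight₁ (u : K) ≤ 1}.Finite := by
      refine ((NumberField.finite_setOfPred_logHeight₁_le K (Module.finrank ℚ K)).preimage
        Units.val_injective.injOn).subset fun u hu => ?_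
      have hu' : logHeight₁ (u : K) ≤ 1 := hu
      rwa [hlog, div_le_one hd] at hu'
    refine ((Set.Finite.pi' fun _ : Fin e => hunits).preimage hinj.injOn).subset fun n hn i => ?_
    exact (Finset.single_le_sum (f := fun i => logHeight₁ (φ n i : K)) (fun i _ => hlog0 _)
      (Finset.mem_univ i)).trans hn
  obtain ⟨C, hC⟩ := exists_le_mul_zNorm H hadd hsmul hnonneg
  obtain ⟨δ, hδ, hle⟩ := exists_pos_le_of_finite H hsmul hnonneg hfin
  obtain ⟨c, hc, hlow⟩ := exists_pos_mul_zNorm_le H hadd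
    (fun k n => by simpa using hsmul k n) (fun n => by simpa using hsmul (-1) n) hC hδ hle
  refine ⟨c, max C (c + 1), hc, lt_max_of_lt_right (lt_add_one c), fun n => ⟨hlow n, ?_⟩⟩
  exact (hC n).trans (mul_le_mul_of_nonneg_right (le_max_left _ _) (Nat.cast_nonneg _))
end
end

section
/- Let $K$ be a number field and let $f : \mathbb{Z}^r \to K^{\times}$ be a purely exponential polynomial (taking values in $K^{\times}$). If the image $f(\mathbb{Z}^r)$ is a subgroup of the multiplicative group $K^{\times}$, then this subgroup is finitely generated. -/
open scoped BigOperators nonZeroDivisors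

noncomputable section

section SUnits

open IsDedekindDomain

variable {R K : Type*} [CommRing R] [IsDedekindDomain R] [Field K] [Algebra R K]
  [IsFractionRing R K]

/-- An element of an algebraic extension of `K` is integral over the valuation ring of `v` for all
but finitely many primes `v`. -/
theorem finite_not_isIntegral_valuationSubring {L : Type*} [Field L] [Algebra K L] [Algebra R L]
    [IsScalarTower R K L] [Algebra.IsAlgebraic K L] (z : L) :
    {v : HeightOneSpectrum R | ¬ IsIntegral (v.valuation K).valuationSubring z}.Finite := by
  have : Algebra.IsAlgebraic R L := (IsFractionRing.comap_isAlgebraic_iff (K := K)).mpr inferInstance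
  obtain ⟨y, hy, hyz⟩ := (Algebra.IsAlgebraic.isAlgebraic (R := R) z).exists_integral_multiple
  refine (HeightOneSpectrum.Support.finite R (algebraMap R K y)⁻¹).subset fun v hv ↦ ?_
  by_contra hinv
  refine hv ?_
  have hinv : (algebraMap R K y)⁻¹ ∈ (v.valuation K).valuationSubring := (not_lt (α := WithZero (Multiplicative ℤ))).mp hinv
  let φ : R →+* (v.valuation K).valuationSubring :=
    (algebraMap R K).codRestrict _ fun r ↦ v.valuation_le_one r
  have h : IsIntegral (v.valuation K).valuationSubring (y • z) :=
    hyz.map_of_comp_eq φ (RingHom.id L) <| by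
      ext r
      exact (IsScalarTower.algebraMap_apply R K L r).symm
  have hy' : algebraMap R K y ≠ 0 := by simpa using hy
  have hz : z = (⟨_, hinv⟩ : (v.valuation K).valuationSubring) • (y • z) := by
    change z = (algebraMap R K y)⁻¹ • (y • z)
    rw [← algebraMap_smul K y z, inv_smul_smul₀ hy']
  rw [hz]
  exact h.smul _

/-- If the units of a Dedekind domain are finitely generated, then so is any group of `S`-units
with `S` finite. -/
theorem isNoetherian_unit (S : Set (HeightOneSpectrum R)) (hS : S.Finite)
    [Module.Finite ℤ (Additive Rˣ)] : IsNoetherian ℤ (Additive (S.unit K)) := by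
  have := hS.to_subtype
  have hunit (u : Rˣ) (v : HeightOneSpectrum R) : v.valuation K (algebraMap R K u) = 1 := by
    refine le_antisymm (v.valuation_le_one _) ?_
    have h : v.valuation K (algebraMap R K u) * v.valuation K (algebraMap R K ↑u⁻¹) = 1 := by
      rw [← map_mul, ← map_mul, Units.mul_inv, map_one, map_one]
    rw [← h]
    exact mul_le_of_le_one_right' (v.valuation_le_one _)
  let f : Rˣ →* S.unit K := (Units.map (algebraMap R K).toMonoidHom).codRestrict _
    fun u v _ ↦ hunit u v
  let g : S.unit K →* Multiplicative (S → ℤ) :=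
    (MulEquiv.funMultiplicative S ℤ).symm.toMonoidHom.comp <| MonoidHom.pi fun v : S ↦
      (WithZero.unitsWithZeroEquiv.toMonoidHom.comp
        (Units.map (v.1.valuation K).toMonoidWithZeroHom.toMonoidHom)).comp (S.unit K).subtype
  refine isNoetherian_of_range_eq_ker (M := Additive Rˣ) (P := S → ℤ)
    (MonoidHom.toAdditive f).toIntLinearMap
    (MonoidHom.toAdditiveLeft g).toIntLinearMap ?_
  ext x
  have hker : x.toMul ∈ g.ker ↔ ∀ v ∈ S, v.valuation K (x.toMul : Kˣ) = 1 := by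
    have h (v : S) : WithZero.unitsWithZeroEquiv
        (Units.map (v.1.valuation K).toMonoidWithZeroHom.toMonoidHom x.toMul.1) = 1 ↔
        v.1.valuation K (x.toMul : Kˣ) = 1 := by
      rw [EmbeddingLike.map_eq_one_iff, Units.ext_iff]
      rfl
    refine Iff.trans ?_ (forall_congr' h |>.trans Subtype.forall)
    exact funext_iff
  have hrange : x.toMul ∈ f.range ↔ x.toMul ∈ g.ker := by
    rw [hker]
    constructor
    · rintro ⟨u, hu⟩ v -
      rw [← hu]
      exact hunit u v
    · intro h
      have hx (v : HeightOneSpectrum R) : v.valuation K (x.toMul : Kˣ) = 1 := by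
        by_cases hv : v ∈ S
        exacts [h v hv, x.toMul.2 v hv]
      obtain ⟨a, ha⟩ := HeightOneSpectrum.mem_integers_of_valuation_le_one K _ fun v ↦ (hx v).le
      obtain ⟨b, hb⟩ := HeightOneSpectrum.mem_integers_of_valuation_le_one K
        ((x.toMul : Kˣ)⁻¹ : Kˣ) fun v : HeightOneSpectrum R ↦ by
          simp [hx v]
      have hab : a * b = 1 := IsFractionRing.injective R K <| by
        rw [map_mul, ha, hb, Units.mul_inv, map_one]
      exact ⟨⟨a, b, hab, mul_comm a b ▸ hab⟩, Subtype.ext (Units.ext ha)⟩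
  exact hrange

end SUnits

/-- The values in `K` of a purely exponential polynomial lie in the valuation ring of all but
finitely many primes. -/
theorem finite_exists_one_lt_valuation {K : Type*} [Field K] [NumberField K] {r : ℕ}
    (f : (Fin r → ℤ) → K) (hf : PEP.IsPEPoly K (fun m ↦ algebraMap K (AlgebraicClosure K) (f m))) :
    {v : IsDedekindDomain.HeightOneSpectrum (NumberField.RingOfIntegers K) |
      ∃ m, 1 < v.valuation K (f m)}.Finite := by
  obtain ⟨k, lam, e, a, l, h⟩ := hf
  refine ((Set.finite_iUnion fun j ↦ finite_not_isIntegral_valuationSubring (K := K)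
    (a j : AlgebraicClosure K)).union ((Set.finite_iUnion fun i ↦
      finite_not_isIntegral_valuationSubring (K := K) (lam i : AlgebraicClosure K)).union
    (Set.finite_iUnion fun i ↦ finite_not_isIntegral_valuationSubring (K := K)
      (↑(lam i)⁻¹ : AlgebraicClosure K)))).subset ?_
  rintro v ⟨m, hm⟩
  by_contra hv
  simp only [Set.mem_union, Set.mem_iUnion, Set.mem_ofPred, not_or, not_exists, not_not] at hv
  obtain ⟨ha, hl, hl'⟩ := hv
  have hpow (i : Fin k) (n : ℤ) :
      IsIntegral (v.valuation K).valuationSubring (↑(lam i ^ n) : AlgebraicClosure K) := by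
    cases n with
    | ofNat n => simpa using (hl i).pow n
    | negSucc n => simpa [← inv_pow] using (hl' i).pow (n + 1)
  have hint : IsIntegral (v.valuation K).valuationSubring
      (algebraMap K (AlgebraicClosure K) (f m)) := by
    rw [show algebraMap K (AlgebraicClosure K) (f m) = _ from h m]
    exact IsIntegral.sum _ fun j _ ↦ (ha j).mul (IsIntegral.prod _ fun i _ ↦ hpow i _)
  rw [isIntegral_algebraMap_iff (algebraMap K (AlgebraicClosure K)).injective,
    IsIntegrallyClosed.isIntegral_iff] at hint
  obtain ⟨y, hy⟩ := hint
  rw [← hy] at hm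
  exact hm.not_ge y.2

open PEP in
/-- If a purely exponential polynomial `f : ℤ^r → K^×` over a number field `K` has image
a multiplicative subgroup of `K^×`, then this subgroup is finitely generated. -/
theorem pep_image_subgroup_fg {K : Type*} [Field K] [NumberField K] {r : ℕ}
    (f : (Fin r → ℤ) → Kˣ)
    (hf : IsPEPoly K (fun m => algebraMap K (AlgebraicClosure K) ((f m : K))))
    (H : Subgroup Kˣ) (hH : (H : Set Kˣ) = Set.range f) :
    H.FG := by
  set S := {v : IsDedekindDomain.HeightOneSpectrum (NumberField.RingOfIntegers K) |
      ∃ m, 1 < v.valuation K (f m : K)} with hSdef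
  have hS : S.Finite := finite_exists_one_lt_valuation (fun m ↦ (f m : K)) hf
  have hle {x : Kˣ} (hx : x ∈ H) {v} (hv : v ∉ S) : v.valuation K (x : K) ≤ 1 := by
    obtain ⟨m, rfl⟩ : x ∈ Set.range f := hH ▸ hx
    exact not_lt.mp fun hlt ↦ hv ⟨m, hlt⟩
  have hHS : H ≤ S.unit K := fun x hx v hv ↦ by
    refine le_antisymm (hle hx hv) ?_
    have h := hle (H.inv_mem hx) hv
    rw [Units.val_inv_eq_inv_val, map_inv₀] at h
    exact (inv_le_one₀ (by simp [zero_lt_iff])).mp h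
  have := isNoetherian_unit (K := K) S hS
  have : IsNoetherian ℤ (Additive H) := isNoetherian_of_injective
    (MonoidHom.toAdditive (Subgroup.inclusion hHS)).toIntLinearMap
    (Subgroup.inclusion_injective hHS)
  rw [← Group.fg_iff_subgroup_fg, GroupFG.iff_add_fg, ← Module.Finite.iff_addGroup_fg]
  infer_instance
end
end

section
/- Let $K$ be a field of characteristic zero and let $\Gamma \subseteq \mathrm{GL}_n(K)$ be a subgroup of the form $\Gamma = \langle \gamma_1 \rangle \cdots \langle \gamma_r \rangle$ where each $\gamma_i$ is semi-simple (diagonalizable over $\overline{K}$). Then $\Gamma$, viewed as a subset of $K^{n^2}$ via matrix entries, admits a purely exponential parametrization in $r$ variables; more precisely, if $g_i^{-1} \gamma_i g_i = \mathrm{diag}(\lambda_{i,1},\dots,\lambda_{i,n})$ with $g_i \in \mathrm{GL}_n(\overline{K})$, then every element of $\Gamma$ has the form $\prod_{i=1}^r g_i\,\mathrm{diag}(\lambda_{i,1}^{a_i},\dots,\lambda_{i,n}^{a_i})\,g_i^{-1}$ for some $a_1,\dots,a_r \in \mathbb{Z}$, and each matrix entry of this product, as a function of $(a_1,\dots,a_r)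 \in \mathbb{Z}^r$, is a purely exponential polynomial whose bases are among the eigenvalues $\lambda_{i,j}$. -/
open scoped BigOperators nonZeroDivisors

noncomputable section

namespace PEP

section PEPoly

variable {K : Type*} [Field K] {k r : ℕ} {lam : Fin k → (AlgebraicClosure K)ˣ}
  {f f' : (Fin r → ℤ) → AlgebraicClosure K}

/-- The index set of the terms may be any finite type. -/
theorem IsPEPolyWith.of_fintype {ι : Type*} [Fintype ι] (a : ι → (AlgebraicClosure K)ˣ)
    (l : Fin k → ι → ((Fin r → ℤ) →+ ℤ))
    (h : ∀ n, f n = ∑ j, (a j : AlgebraicClosure K) *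
        ∏ i, ((lam i ^ (l i j n) : (AlgebraicClosure K)ˣ) : AlgebraicClosure K)) :
    IsPEPolyWith K lam f := by
  refine ⟨Fintype.card ι, fun j => a ((Fintype.equivFin ι).symm j),
    fun i j => l i ((Fintype.equivFin ι).symm j), fun n => ?_⟩
  rw [h, ← Equiv.sum_comp (Fintype.equivFin ι).symm]

theorem IsPEPolyWith.zero : IsPEPolyWith K lam (fun _ : Fin r → ℤ => 0) :=
  ⟨0, Fin.elim0, fun _ => Fin.elim0, fun _ => by simp⟩

theorem IsPEPolyWith.const (c : AlgebraicClosure K) :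
    IsPEPolyWith K lam (fun _ : Fin r → ℤ => c) := by
  by_cases hc : c = 0
  · subst hc
    exact .zero
  · exact .of_fintype (ι := Unit) (fun _ => Units.mk0 c hc) (fun _ _ => 0) (by simp)

theorem IsPEPolyWith.zpow (q : Fin k) (i : Fin r) :
    IsPEPolyWith K lam (fun n : Fin r → ℤ =>
      ((lam q ^ n i : (AlgebraicClosure K)ˣ) : AlgebraicClosure K)) := by
  refine .of_fintype (ι := Unit) (fun _ => 1)
    (fun q' _ => if q' = q then Pi.evalAddMonoidHom _ i else 0) fun n => ?_
  rw [Fintype.sum_unique, Finset.prod_eq_single q]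
  · simp
  · intro b _ hb
    simp [hb]
  · simp

theorem IsPEPolyWith.add (hf : IsPEPolyWith K lam f) (hf' : IsPEPolyWith K lam f') :
    IsPEPolyWith K lam (fun n => f n + f' n) := by
  obtain ⟨e, a, l, h⟩ := hf
  obtain ⟨e', a', l', h'⟩ := hf'
  refine .of_fintype (ι := Fin e ⊕ Fin e') (Sum.elim a a')
    (fun i => Sum.elim (l i) (l' i)) fun n => ?_
  simp [h, h']

theorem IsPEPolyWith.mul (hf : IsPEPolyWith K lam f) (hf' : IsPEPolyWith K lam f') :
    IsPEPolyWith K lam (fun n => f n * f' n) := by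
  obtain ⟨e, a, l, h⟩ := hf
  obtain ⟨e', a', l', h'⟩ := hf'
  refine .of_fintype (ι := Fin e × Fin e') (fun j => a j.1 * a' j.2)
    (fun i j => l i j.1 + l' i j.2) fun n => ?_
  rw [h, h', Finset.sum_mul_sum, Fintype.sum_prod_type]
  refine Finset.sum_congr rfl fun x _ => Finset.sum_congr rfl fun y _ => ?_
  simp only [AddMonoidHom.add_apply, zpow_add, Units.val_mul, Finset.prod_mul_distrib]
  ring

theorem IsPEPolyWith.sum {ι : Type*} (s : Finset ι)
    {f : ι → (Fin r → ℤ) → AlgebraicClosure K} (h : ∀ j ∈ s, IsPEPolyWith K lam (f j)) :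
    IsPEPolyWith K lam (fun n => ∑ j ∈ s, f j n) := by
  classical
  induction s using Finset.induction_on with
  | empty => simpa using IsPEPolyWith.zero
  | insert b s hb ih =>
    simp only [Finset.sum_insert hb]
    exact (h b (by simp)).add (ih fun j hj => h j (by simp [hj]))

theorem IsPEPolyWith.list_prod_apply {ι m : Type*} [Fintype m] [DecidableEq m] (L : List ι)
    {M : ι → (Fin r → ℤ) → Matrix m m (AlgebraicClosure K)}
    (h : ∀ i ∈ L, ∀ x y, IsPEPolyWith K lam (fun n => M i n x y)) (x y : m) :
    IsPEPolyWith K lam (fun n => (L.map fun i => M i n).prod x y) := by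
  induction L generalizing x with
  | nil => exact .const _
  | cons b L ih =>
    simp only [List.map_cons, List.prod_cons, Matrix.mul_apply]
    exact .sum _ fun z _ =>
      (h b (by simp) x z).mul (ih (fun i hi => h i (by simp [hi])) z)

end PEPoly

/-- Powers of a diagonalized invertible matrix. -/
theorem map_zpow_eq_conj_diagonal {R S m : Type*} [CommRing R] [CommRing S] [Fintype m]
    [DecidableEq m] (φ : R →+* S) (A : (Matrix m m R)ˣ) (g : (Matrix m m S)ˣ) (d : m → Sˣ)
    (h : (↑g⁻¹ : Matrix m m S) * (A : Matrix m m R).map φ * (g : Matrix m m S) =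
      Matrix.diagonal (fun j => (d j : S))) (a : ℤ) :
    ((A ^ a : (Matrix m m R)ˣ) : Matrix m m R).map φ =
      (g : Matrix m m S) * Matrix.diagonal (fun j => ((d j ^ a : Sˣ) : S)) *
        (↑g⁻¹ : Matrix m m S) := by
  let D : (m → Sˣ) →* (Matrix m m S)ˣ :=
    (Units.map (Matrix.diagonalRingHom m S : (m → S) →* Matrix m m S)).comp
      MulEquiv.piUnits.symm.toMonoidHom
  let Φ : (Matrix m m R)ˣ →* (Matrix m m S)ˣ :=
    Units.map (φ.mapMatrix : Matrix m m R →+* Matrix m m S).toMonoidHom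
  have hA : Φ A = g * D d * g⁻¹ := by
    rw [eq_mul_inv_iff_mul_eq, ← inv_mul_eq_iff_eq_mul, ← mul_assoc]
    exact Units.ext h
  have key : Φ (A ^ a) = g * D (d ^ a) * g⁻¹ := by
    rw [map_zpow, hA, conj_zpow, map_zpow]
  exact congrArg Units.val key

end PEP

open PEP in
/-- A subgroup `Γ = ⟨γ₁⟩ ⋯ ⟨γᵣ⟩ ⊆ GL_n(K)` (`K` of characteristic zero) boundedly
generated by semi-simple elements admits a purely exponential parametrization in `r`
variables: if `gᵢ⁻¹ γᵢ gᵢ = diag(λ_{i,1}, …, λ_{i,n})` over the algebraic closure, then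
every element of `Γ` equals `∏ᵢ gᵢ diag(λ_{i,1}^{aᵢ}, …, λ_{i,n}^{aᵢ}) gᵢ⁻¹` for some
`a ∈ ℤ^r`, each matrix entry of this product is a purely exponential polynomial in `a`
with bases among the eigenvalues `λ_{i,j}`, and the set of entry-tuples of elements of
`Γ` is a PEP set in `r` variables. -/
theorem bg_semisimple_is_pep {K : Type*} [Field K] [CharZero K] {n r : ℕ}
    (Γ : Subgroup (Matrix (Fin n) (Fin n) K)ˣ)
    (γ : Fin r → (Matrix (Fin n) (Fin n) K)ˣ)
    (hΓ : ∀ x : (Matrix (Fin n) (Fin n) K)ˣ,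
      x ∈ Γ ↔ ∃ m : Fin r → ℤ, x = (List.ofFn (fun i => γ i ^ m i)).prod)
    (g : Fin r → (Matrix (Fin n) (Fin n) (AlgebraicClosure K))ˣ)
    (lam : Fin r → Fin n → (AlgebraicClosure K)ˣ)
    (hdiag : ∀ i,
      (↑(g i)⁻¹ : Matrix (Fin n) (Fin n) (AlgebraicClosure K)) *
          ((γ i : Matrix (Fin n) (Fin n) K).map (algebraMap K (AlgebraicClosure K))) *
          (g i : Matrix (Fin n) (Fin n) (AlgebraicClosure K)) =
        Matrix.diagonal (fun j => (lam i j : AlgebraicClosure K)))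
    (F : (Fin r → ℤ) → Matrix (Fin n) (Fin n) (AlgebraicClosure K))
    (hF : ∀ a : Fin r → ℤ,
      F a = (List.ofFn (fun i =>
        (g i : Matrix (Fin n) (Fin n) (AlgebraicClosure K)) *
          Matrix.diagonal (fun j => ((lam i j ^ a i : (AlgebraicClosure K)ˣ) : AlgebraicClosure K)) *
          (↑(g i)⁻¹ : Matrix (Fin n) (Fin n) (AlgebraicClosure K)))).prod) :
    (∀ x ∈ Γ, ∃ a : Fin r → ℤ,
        (x : Matrix (Fin n) (Fin n) K).map (algebraMap K (AlgebraicClosure K)) = F a) ∧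
    (∀ p : Fin n × Fin n,
        IsPEPolyWith K
          (fun q : Fin (r * n) =>
            (fun pr : Fin r × Fin n => lam pr.1 pr.2) (finProdFinEquiv.symm q))
          (fun a => F a p.1 p.2)) ∧
    IsPEPSet K r
      ((fun A : (Matrix (Fin n) (Fin n) K)ˣ =>
        entries (A : Matrix (Fin n) (Fin n) K)) '' Γ) := by
  have hmap : ∀ a : Fin r → ℤ,
      (((List.ofFn (fun i => γ i ^ a i)).prod : (Matrix (Fin n) (Fin n) K)ˣ) :
        Matrix (Fin n) (Fin n) K).map (algebraMap K (AlgebraicClosure K)) = F a := by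
    intro a
    rw [hF, ← RingHom.mapMatrix_apply, ← Units.coeHom_apply, map_list_prod, map_list_prod,
      List.map_ofFn, List.map_ofFn]
    congr 2
    funext i
    exact map_zpow_eq_conj_diagonal _ (γ i) (g i) (lam i) (hdiag i) (a i)
  have hpoly : ∀ p : Fin n × Fin n,
      IsPEPolyWith K
        (fun q : Fin (r * n) =>
          (fun pr : Fin r × Fin n => lam pr.1 pr.2) (finProdFinEquiv.symm q))
        (fun a => F a p.1 p.2) := by
    intro p
    simp only [hF, List.ofFn_eq_map]
    refine IsPEPolyWith.list_prod_apply (M := fun i (a : Fin r → ℤ) =>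
      (g i : Matrix (Fin n) (Fin n) (AlgebraicClosure K)) *
        Matrix.diagonal (fun j => ((lam i j ^ a i : (AlgebraicClosure K)ˣ) : AlgebraicClosure K)) *
        (↑(g i)⁻¹ : Matrix (Fin n) (Fin n) (AlgebraicClosure K))) _ (fun i _ x y => ?_) p.1 p.2
    simp_rw [Matrix.mul_apply (M := _ * Matrix.diagonal _), Matrix.mul_diagonal]
    refine .sum _ fun j _ => ((IsPEPolyWith.const _).mul ?_).mul (.const _)
    simpa using IsPEPolyWith.zpow (lam := fun q : Fin (r * n) =>
      lam (finProdFinEquiv.symm q).1 (finProdFinEquiv.symm q).2) (finProdFinEquiv (i, j)) i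
  refine ⟨fun x hx => ?_, hpoly, fun p a => F a p.1 p.2, fun p => ⟨_, _, hpoly p⟩,
    fun a => ?_, ?_⟩
  · obtain ⟨a, rfl⟩ := (hΓ x).1 hx
    exact ⟨a, hmap a⟩
  · exact ⟨_, ⟨_, (hΓ _).2 ⟨a, rfl⟩, rfl⟩, fun p => congrFun (congrFun (hmap a) p.1) p.2⟩
  · rintro _ ⟨x, hx, rfl⟩
    obtain ⟨a, rfl⟩ := (hΓ x).1 hx
    exact ⟨a, fun p => congrFun (congrFun (hmap a) p.1) p.2⟩
end
end

section
/- Let $K$ be a number field and let $g \in \mathrm{GL}_n(K)$ be a unipotent matrix. Then there exist constants $c > 0$ and $d \ge 0$ such that for all integers $k \ge 1$, the affine multiplicative height of $g^k$ (viewed as a point of $K^{n^2}$ via its entries) satisfies $H_{\mathrm{aff}}(g^k) \le c \cdot k^d$; equivalently, $h_{\mathrm{aff}}(g^k) = O(\log k)$ as $k \to \infty$. -/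
open scoped BigOperators nonZeroDivisors

noncomputable section

open NumberField in
/-- If the integer `b` clears the denominators of all coordinates of `x`, then the norm of the
denominator ideal of `x` is at least `1 / |N(b)|`. -/
theorem inv_absNorm_denomIdeal_le {K : Type*} [Field K] [NumberField K] {ι : Type*} [Fintype ι]
    {b : K} (hb : b ≠ 0) (hb_int : IsIntegral ℤ b) (x : ι → K)
    (hx : ∀ i, IsIntegral ℤ (b * x i)) :
    (((FractionalIdeal.absNorm (PEP.denomIdeal x) : ℚ) : ℝ))⁻¹ ≤
      ((|Algebra.norm ℚ b| : ℚ) : ℝ) := by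
  have mem_one {y : K} (hy : IsIntegral ℤ y) :
      FractionalIdeal.spanSingleton (𝓞 K)⁰ y ≤ 1 := by
    rw [FractionalIdeal.spanSingleton_le_iff_mem, FractionalIdeal.mem_one_iff]
    exact ⟨⟨y, hy⟩, rfl⟩
  have hle : FractionalIdeal.spanSingleton (𝓞 K)⁰ b * PEP.denomIdeal x ≤ 1 := by
    rw [PEP.denomIdeal, mul_add, mul_one, Finset.mul_sum, ← FractionalIdeal.sup_eq_add]
    refine sup_le (mem_one hb_int) ?_
    refine Finset.sum_induction _ (· ≤ 1) (fun I J hI hJ ↦ ?_) bot_le fun i _ ↦ ?_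
    · rw [← FractionalIdeal.sup_eq_add]
      exact sup_le hI hJ
    · rw [FractionalIdeal.spanSingleton_mul_spanSingleton]
      exact mem_one (hx i)
  obtain ⟨A, hA⟩ := FractionalIdeal.le_one_iff_exists_coeIdeal.mp hle
  have hI : PEP.denomIdeal x ≠ 0 := by
    intro h
    have : (1 : FractionalIdeal (𝓞 K)⁰ K) ≤ PEP.denomIdeal x := by
      rw [PEP.denomIdeal, ← FractionalIdeal.sup_eq_add]
      exact le_sup_left
    rw [h, ← FractionalIdeal.bot_eq_zero, le_bot_iff, FractionalIdeal.bot_eq_zero] at this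
    exact one_ne_zero this
  have hA0 : A ≠ ⊥ := by
    rintro rfl
    rw [FractionalIdeal.coeIdeal_bot, eq_comm, mul_eq_zero,
      FractionalIdeal.spanSingleton_eq_zero_iff] at hA
    exact hA.elim hb hI
  have hnorm : (1 : ℚ) ≤ |Algebra.norm ℚ b| * FractionalIdeal.absNorm (PEP.denomIdeal x) := by
    rw [← FractionalIdeal.absNorm_span_singleton (R := 𝓞 K), ← map_mul, ← hA,
      FractionalIdeal.coeIdeal_absNorm]
    exact_mod_cast Nat.one_le_iff_ne_zero.mpr (Ideal.absNorm_eq_zero_iff.not.mpr hA0)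
  have hpos : (0 : ℚ) < FractionalIdeal.absNorm (PEP.denomIdeal x) :=
    (FractionalIdeal.absNorm_nonneg _).lt_of_ne'
      (FractionalIdeal.absNorm_eq_zero_iff.not.mpr hI)
  rw [inv_le_iff_one_le_mul₀ (by exact_mod_cast hpos)]
  exact_mod_cast hnorm

/-- The height of `x` is bounded by a geometric mean of bounds for its absolute values. -/
theorem mulHeight_le_of_infinitePlace_le {K : Type*} [Field K] [NumberField K] {ι : Type*}
    [Fintype ι] {b : K} (hb : b ≠ 0) (hb_int : IsIntegral ℤ b) (x : ι → K)
    (hx : ∀ i, IsIntegral ℤ (b * x i)) {C : NumberField.InfinitePlace K → ℝ} (hC : ∀ w, 1 ≤ C w)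
    {t : ℝ} (ht : 1 ≤ t) (hw : ∀ w i, w (x i) ≤ C w * t) :
    PEP.mulHeight x ≤
      ((∏ w, C w ^ w.mult) * ((|Algebra.norm ℚ b| : ℚ) : ℝ)) ^ ((Module.finrank ℚ K : ℝ)⁻¹) *
        t := by
  have hC0 (w) : 0 ≤ C w := zero_le_one.trans (hC w)
  have ht0 : 0 ≤ t := zero_le_one.trans ht
  have hprod : ∏ w : NumberField.InfinitePlace K, max 1 (⨆ i, w (x i)) ^ w.mult ≤
      (∏ w, C w ^ w.mult) * t ^ Module.finrank ℚ K := by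
    rw [← NumberField.InfinitePlace.sum_mult_eq, ← Finset.prod_pow_eq_pow_sum,
      ← Finset.prod_mul_distrib]
    refine Finset.prod_le_prod (fun w _ ↦ by positivity) fun w _ ↦ ?_
    rw [← mul_pow]
    refine pow_le_pow_left₀ (by positivity) (max_le ?_ ?_) _
    · exact one_le_mul_of_one_le_of_one_le (hC w) ht
    · exact Real.iSup_le (hw w) (mul_nonneg (hC0 w) ht0)
  have hCprod : 0 ≤ ∏ w, C w ^ w.mult := Finset.prod_nonneg fun w _ ↦ pow_nonneg (hC0 w) _
  have hN : (0 : ℝ) ≤ ((|Algebra.norm ℚ b| : ℚ) : ℝ) := by exact_mod_cast abs_nonneg _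
  have hI : (0 : ℝ) ≤ (((FractionalIdeal.absNorm (PEP.denomIdeal x) : ℚ) : ℝ))⁻¹ :=
    inv_nonneg.mpr (by exact_mod_cast FractionalIdeal.absNorm_nonneg _)
  calc PEP.mulHeight x
      ≤ ((∏ w, C w ^ w.mult) * t ^ Module.finrank ℚ K * ((|Algebra.norm ℚ b| : ℚ) : ℝ)) ^
          ((Module.finrank ℚ K : ℝ)⁻¹) := by
        refine Real.rpow_le_rpow ?_ ?_ (by positivity)
        · exact mul_nonneg (Finset.prod_nonneg fun w _ ↦ by positivity) hI
        · exact mul_le_mul hprod (inv_absNorm_denomIdeal_le hb hb_int x hx) hI (by positivity)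
    _ = _ := by
        rw [mul_right_comm, Real.mul_rpow (mul_nonneg hCprod hN) (by positivity),
          Real.pow_rpow_inv_natCast ht0 Module.finrank_pos.ne']

/-- Powers of `1 + N` with `N ^ m = 0` are given by a binomial expansion of length `m`. -/
theorem one_add_pow_eq_sum_range_of_pow_eq_zero {R : Type*} [Ring R] {N : R} {m : ℕ}
    (hN : N ^ m = 0) (k : ℕ) :
    (1 + N) ^ k = ∑ i ∈ Finset.range m, (k.choose i : R) * N ^ i := by
  have h1 : (1 + N) ^ k = ∑ i ∈ Finset.range (k + 1), (k.choose i : R) * N ^ i := by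
    rw [add_comm, (Commute.one_right N).add_pow]
    exact Finset.sum_congr rfl fun i _ ↦ by rw [one_pow, mul_one, Nat.cast_comm]
  rw [h1]
  trans ∑ i ∈ Finset.range (max (k + 1) m), (k.choose i : R) * N ^ i
  · refine Finset.sum_subset (Finset.range_mono (le_max_left _ _)) fun i _ hi ↦ ?_
    rw [Nat.choose_eq_zero_of_lt (by simpa using hi), Nat.cast_zero, zero_mul]
  · refine (Finset.sum_subset (Finset.range_mono (le_max_right _ _)) fun i _ hi ↦ ?_).symm
    rw [pow_eq_zero_of_le (by simpa using hi) hN, mul_zero]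

open PEP in
/-- The powers of a unipotent matrix `g ∈ GL_n(K)` (`K` a number field) have polynomially
bounded affine multiplicative height: `H_aff(gᵏ) ≤ c kᵈ` for all `k ≥ 1`; equivalently
`h_aff(gᵏ) = O(log k)`. -/
theorem unipotent_powers_height_poly {K : Type*} [Field K] [NumberField K] {n : ℕ}
    (g : (Matrix (Fin n) (Fin n) K)ˣ)
    (hg : IsNilpotent ((g : Matrix (Fin n) (Fin n) K) - 1)) :
    ∃ c : ℝ, 0 < c ∧ ∃ d : ℕ, ∀ k : ℕ, 1 ≤ k →
      mulHeight (entries ((g ^ k : (Matrix (Fin n) (Fin n) K)ˣ) : Matrix (Fin n) (Fin n) K)) ≤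
        c * (k : ℝ) ^ d := by
  obtain ⟨m, hm⟩ := hg
  set N : Matrix (Fin n) (Fin n) K := (g : Matrix (Fin n) (Fin n) K) - 1 with hN
  have hpow (k : ℕ) (p : Fin n × Fin n) :
      entries ((g ^ k : (Matrix (Fin n) (Fin n) K)ˣ) : Matrix (Fin n) (Fin n) K) p =
        ∑ i ∈ Finset.range m, (k.choose i : K) * (N ^ i) p.1 p.2 := by
    have hgN : (g : Matrix (Fin n) (Fin n) K) = 1 + N := by rw [hN, add_sub_cancel]
    rw [entries, Units.val_pow_eq_pow_val, hgN, one_add_pow_eq_sum_range_of_pow_eq_zero hm,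
      Matrix.sum_apply]
    exact Finset.sum_congr rfl fun i _ ↦ by
      rw [← nsmul_eq_mul, Matrix.smul_apply, nsmul_eq_mul]
  obtain ⟨b, hb⟩ := IsLocalization.exist_integer_multiples_of_finite (NumberField.RingOfIntegers K)⁰
    fun q : Fin m × Fin n × Fin n ↦ (N ^ (q.1 : ℕ)) q.2.1 q.2.2
  have hb0 : (algebraMap (NumberField.RingOfIntegers K) K b) ≠ 0 := by simp
  have hb_int : IsIntegral ℤ (algebraMap (NumberField.RingOfIntegers K) K b) :=
    (b : NumberField.RingOfIntegers K).isIntegral_coe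
  have hx_int (k : ℕ) (p : Fin n × Fin n) :
      IsIntegral ℤ (algebraMap (NumberField.RingOfIntegers K) K b *
        entries ((g ^ k : (Matrix (Fin n) (Fin n) K)ˣ) : Matrix (Fin n) (Fin n) K) p) := by
    rw [hpow, Finset.mul_sum]
    refine IsIntegral.sum _ fun i hi ↦ ?_
    obtain ⟨y, hy⟩ := hb (⟨i, Finset.mem_range.mp hi⟩, p)
    rw [mul_left_comm, ← Algebra.smul_def]
    refine IsIntegral.mul (isIntegral_natCast _) ?_
    have hy' : (y : K) = (b : NumberField.RingOfIntegers K) • (N ^ i) p.1 p.2 := hy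
    rw [← hy']
    exact y.isIntegral_coe
  set C : NumberField.InfinitePlace K → ℝ := fun w ↦
    1 + ∑ p : Fin n × Fin n, ∑ i ∈ Finset.range m, w ((N ^ i) p.1 p.2) with hC
  have hC1 (w) : 1 ≤ C w :=
    le_add_of_nonneg_right <| Finset.sum_nonneg fun _ _ ↦ Finset.sum_nonneg fun _ _ ↦
      apply_nonneg w _
  refine ⟨_, ?_, m, fun k hk ↦ mulHeight_le_of_infinitePlace_le hb0 hb_int _ (hx_int k) hC1
    (one_le_pow₀ (by exact_mod_cast hk)) fun w p ↦ ?_⟩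
  · refine Real.rpow_pos_of_pos (mul_pos ?_ ?_) _
    · exact Finset.prod_pos fun w _ ↦ pow_pos (zero_lt_one.trans_le (hC1 w)) _
    · exact_mod_cast abs_pos.mpr (Algebra.norm_ne_zero_iff.mpr hb0)
  have hk1 : (1 : ℝ) ≤ k := by exact_mod_cast hk
  calc w (entries ((g ^ k : (Matrix (Fin n) (Fin n) K)ˣ) : Matrix (Fin n) (Fin n) K) p)
      ≤ ∑ i ∈ Finset.range m, w ((k.choose i : K) * (N ^ i) p.1 p.2) := by
        rw [hpow]
        exact w.1.sum_le _ _
    _ ≤ ∑ i ∈ Finset.range m, w ((N ^ i) p.1 p.2) * (k : ℝ) ^ m := by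
        refine Finset.sum_le_sum fun i hi ↦ ?_
        rw [map_mul, NumberField.InfinitePlace.map_natCast, mul_comm]
        refine mul_le_mul_of_nonneg_left ?_ (apply_nonneg w _)
        calc (k.choose i : ℝ) ≤ (k : ℝ) ^ i := by exact_mod_cast Nat.choose_le_pow k i
          _ ≤ (k : ℝ) ^ m := pow_le_pow_right₀ hk1 (Finset.mem_range.mp hi).le
    _ ≤ C w * (k : ℝ) ^ m := by
        rw [← Finset.sum_mul]
        refine mul_le_mul_of_nonneg_right ?_ (by positivity)
        have := Finset.single_le_sum
          (f := fun p : Fin n × Fin n ↦ ∑ i ∈ Finset.range m, w ((N ^ i) p.1 p.2))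
          (fun _ _ ↦ Finset.sum_nonneg fun _ _ ↦ apply_nonneg w _) (Finset.mem_univ p)
        simp only [hC]
        linarith
end
end
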